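/- Let n ≥ 2 and let A be an n×n real matrix with ‖Ax‖_P ≤ ‖x‖_P for all x ∈ ℝ^n. Then for every pair of disjoint nonempty subsets S, T of {1,…,n}, exactly one of the following holds: (i) A maps the open double-face D_{S,T} into the open unit ball {x : ‖x‖_P < 1}; or (ii) there exist disjoint nonempty subsets S', T' of {1,…,n}, unique up to swapping S' and T', such that A maps D_{S,T} into D_{S',T'}. -/

import Mathlib

open Matrix

/-- The seminorm `‖x‖_P = (1/2)(max_i x_i − min_i x_i)`. -/
noncomputable def normP {n : ℕ} (x : Fin n → ℝ) : ℝ :=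
  (1 / 2) * ((⨆ i, x i) - ⨅ i, x i)

/-- The open face `O_{S,T}` of the unit ball of `‖·‖_P`: points with
`max − min = 2`, whose set of minimizers is `S` and set of maximizers is `T`. -/
def Oface {n : ℕ} (S T : Set (Fin n)) : Set (Fin n → ℝ) :=
  {x | (⨆ k, x k) - (⨅ k, x k) = 2 ∧
    {i | x i = ⨅ k, x k} = S ∧ {i | x i = ⨆ k, x k} = T}

/-- The open double-face `D_{S,T} = O_{S,T} ∪ O_{T,S}`. -/
def Dface {n : ℕ} (S T : Set (Fin n)) : Set (Fin n → ℝ) :=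
  Oface S T ∪ Oface T S

lemma mem_Oface_iff {n : ℕ} {S T : Set (Fin n)} (hS : S.Nonempty) (hT : T.Nonempty)
    {x : Fin n → ℝ} :
    x ∈ Oface S T ↔ ∃ m, (∀ i ∈ S, x i = m) ∧ (∀ i ∈ T, x i = m + 2) ∧
      ∀ i, i ∉ S → i ∉ T → m < x i ∧ x i < m + 2 := by
  have : Nonempty (Fin n) := hS.to_type
  have hle : ∀ i, x i ≤ ⨆ k, x k := le_ciSup (Set.finite_range _).bddAbove
  have hge : ∀ i, (⨅ k, x k) ≤ x i := ciInf_le (Set.finite_range _).bddBelow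
  constructor
  · rintro ⟨h, rfl, rfl⟩
    have h' : (⨅ k, x k) + 2 = ⨆ k, x k := by linarith
    rw [← h'] at hle ⊢
    exact ⟨_, fun i hi => hi, fun i hi => hi,
      fun i h1 h2 => ⟨(hge i).lt_of_ne' h1, (hle i).lt_of_ne h2⟩⟩
  · rintro ⟨m, h1, h2, h3⟩
    obtain ⟨s, hs⟩ := hS
    obtain ⟨t, ht⟩ := hT
    have hb : ∀ i, m ≤ x i ∧ x i ≤ m + 2 := by
      intro i
      by_cases hiS : i ∈ S
      · simp [h1 i hiS]
      by_cases hiT : i ∈ T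
      · simp [h2 i hiT]
      exact (h3 i hiS hiT).imp le_of_lt le_of_lt
    have hinf : ⨅ k, x k = m := le_antisymm (h1 s hs ▸ hge s) (le_ciInf fun i => (hb i).1)
    have hsup : ⨆ k, x k = m + 2 := le_antisymm (ciSup_le fun i => (hb i).2) (h2 t ht ▸ hle t)
    refine ⟨by rw [hinf, hsup]; ring, ?_, ?_⟩
    · ext i
      rw [Set.mem_ofPred_eq, hinf]
      refine ⟨fun hi => ?_, h1 i⟩
      by_contra hiS
      by_cases hiT : i ∈ T
      · linarith [h2 i hiT]
      · exact (h3 i hiS hiT).1.ne' hi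
    · ext i
      rw [Set.mem_ofPred_eq, hsup]
      refine ⟨fun hi => ?_, h2 i⟩
      by_contra hiT
      by_cases hiS : i ∈ S
      · linarith [h1 i hiS]
      · exact (h3 i hiS hiT).2.ne hi

lemma normP_eq_one {n : ℕ} {S T : Set (Fin n)} {x : Fin n → ℝ} (hx : x ∈ Oface S T) :
    normP x = 1 := by
  rw [normP, hx.1]
  norm_num

lemma sub_le_two_mul_normP {n : ℕ} (x : Fin n → ℝ) (i j : Fin n) :
    x i - x j ≤ 2 * normP x := by
  have h1 : x i ≤ ⨆ k, x k := le_ciSup (Set.finite_range _).bddAbove i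
  have h2 : (⨅ k, x k) ≤ x j := ciInf_le (Set.finite_range _).bddBelow j
  unfold normP
  linarith

open Filter Topology in
/-- A face contains, with any two of its points, a continuation of the segment joining them. -/
lemma exists_pos_add_smul_sub_mem_Oface {n : ℕ} {S T : Set (Fin n)} (hS : S.Nonempty)
    (hT : T.Nonempty) {x y : Fin n → ℝ} (hx : x ∈ Oface S T) (hy : y ∈ Oface S T) :
    ∃ ε : ℝ, 0 < ε ∧ x + ε • (x - y) ∈ Oface S T := by
  rw [mem_Oface_iff hS hT] at hx hy
  obtain ⟨a, hxS, hxT, hx⟩ := hx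
  obtain ⟨b, hyS, hyT, -⟩ := hy
  have key : ∀ᶠ ε : ℝ in 𝓝 0, ∀ i, i ∉ S → i ∉ T →
      a + ε * (a - b) < x i + ε * (x i - y i) ∧
        x i + ε * (x i - y i) < a + ε * (a - b) + 2 := by
    refine eventually_all.2 fun i => ?_
    by_cases hiS : i ∈ S
    · simp [hiS]
    by_cases hiT : i ∈ T
    · simp [hiT]
    have h1 : Continuous fun ε : ℝ => a + ε * (a - b) := by fun_prop
    have h2 : Continuous fun ε : ℝ => x i + ε * (x i - y i) := by fun_prop
    have h3 : Continuous fun ε : ℝ => a + ε * (a - b) + 2 := by fun_prop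
    filter_upwards [h1.continuousAt.eventually_lt h2.continuousAt
      (by simpa using (hx i hiS hiT).1), h2.continuousAt.eventually_lt h3.continuousAt
      (by simpa using (hx i hiS hiT).2)] with ε h h' _ _ using ⟨h, h'⟩
  obtain ⟨ε, h, hε⟩ :=
    ((key.filter_mono nhdsWithin_le_nhds).and (self_mem_nhdsWithin (s := Set.Ioi (0 : ℝ)))).exists
  refine ⟨ε, hε, (mem_Oface_iff hS hT).2 ⟨a + ε * (a - b), fun i hi => ?_, fun i hi => ?_, ?_⟩⟩
  · simp [hxS i hi, hyS i hi]
  · simp [hxT i hi, hyT i hi]; ring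
  · simpa using h

lemma neg_mem_Oface {n : ℕ} {S T : Set (Fin n)} (hS : S.Nonempty) (hT : T.Nonempty)
    {x : Fin n → ℝ} (hx : x ∈ Oface S T) : -x ∈ Oface T S := by
  rw [mem_Oface_iff hS hT] at hx
  obtain ⟨m, h1, h2, h3⟩ := hx
  refine (mem_Oface_iff hT hS).2 ⟨-m - 2, fun i hi => ?_, fun i hi => ?_, fun i hiT hiS => ?_⟩
  · simp [h2 i hi]; ring
  · simp [h1 i hi]
  · have := h3 i hiS hiT
    simp only [Pi.neg_apply]
    constructor <;> linarith

lemma normP_neg {n : ℕ} (x : Fin n → ℝ) : normP (-x) = normP x := by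
  have h1 : (⨆ i, (-x) i) = -⨅ i, x i := by
    simp only [iSup, iInf, Real.sInf_def, neg_neg]
    congr 1
    ext r
    simp [neg_eq_iff_eq_neg]
  have h2 : (⨅ i, (-x) i) = -⨆ i, x i := by
    simp only [iSup, iInf, Real.sInf_def]
    congr 2
    ext r
    simp
  rw [normP, normP, h1, h2]
  ring

lemma Oface_nonempty {n : ℕ} {S T : Set (Fin n)} (hST : Disjoint S T) (hS : S.Nonempty)
    (hT : T.Nonempty) : (Oface S T).Nonempty := by
  classical
  refine ⟨fun i => if i ∈ S then -1 else if i ∈ T then 1 else 0,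
    (mem_Oface_iff hS hT).2 ⟨-1, fun i hi => by simp [hi], fun i hi => ?_, fun i h1 h2 => ?_⟩⟩
  · simp [hST.notMem_of_mem_right hi, hi]
    norm_num
  · simp [h1, h2]

/-- If a nonexpansive matrix sends a point of a face to the unit sphere, it sends every other
point of that face to the same closed face as that point. -/
lemma argmin_argmax_mulVec_subset {n : ℕ} {A : Matrix (Fin n) (Fin n) ℝ}
    (hA : ∀ x : Fin n → ℝ, normP (A.mulVec x) ≤ normP x) {S T : Set (Fin n)} (hS : S.Nonempty)
    (hT : T.Nonempty) {x y : Fin n → ℝ} (hx : x ∈ Oface S T) (hy : y ∈ Oface S T)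
    (hAx : normP (A.mulVec x) = 1) :
    normP (A.mulVec y) = 1 ∧
      {i | A.mulVec x i = ⨅ k, A.mulVec x k} ⊆ {i | A.mulVec y i = ⨅ k, A.mulVec y k} ∧
      {i | A.mulVec x i = ⨆ k, A.mulVec x k} ⊆ {i | A.mulVec y i = ⨆ k, A.mulVec y k} := by
  have : Nonempty (Fin n) := hS.to_type
  obtain ⟨ε, hε, hz⟩ := exists_pos_add_smul_sub_mem_Oface hS hT hx hy
  have hAy : normP (A.mulVec y) ≤ 1 := (hA y).trans_eq (normP_eq_one hy)
  have hAz := (hA _).trans_eq (normP_eq_one hz)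
  have key : ∀ i j, A.mulVec x i = (⨆ k, A.mulVec x k) → A.mulVec x j = (⨅ k, A.mulVec x k) →
      A.mulVec y i - A.mulVec y j = 2 := by
    intro i j hi hj
    have h2 := sub_le_two_mul_normP (A.mulVec y) i j
    have h3 := sub_le_two_mul_normP (A.mulVec (x + ε • (x - y))) i j
    simp only [Matrix.mulVec_add, Matrix.mulVec_smul, Matrix.mulVec_sub, Pi.add_apply,
      Pi.smul_apply, Pi.sub_apply, smul_eq_mul] at h3 hAz
    unfold normP at hAx
    have h1 : A.mulVec x i - A.mulVec x j = 2 := by linarith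
    have h4 : ε * (2 - (A.mulVec y i - A.mulVec y j)) ≤ 0 := by
      linear_combination h3 + 2 * hAz - (1 + ε) * h1
    have h5 := nonpos_of_mul_nonpos_right h4 hε
    linarith
  obtain ⟨i₀, hi₀⟩ := exists_eq_ciSup_of_finite (f := A.mulVec x)
  obtain ⟨j₀, hj₀⟩ := exists_eq_ciInf_of_finite (f := A.mulVec x)
  have hle : ∀ i, A.mulVec y i ≤ ⨆ k, A.mulVec y k := le_ciSup (Set.finite_range _).bddAbove
  have hge : ∀ i, (⨅ k, A.mulVec y k) ≤ A.mulVec y i := ciInf_le (Set.finite_range _).bddBelow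
  have hosc : (⨆ k, A.mulVec y k) - (⨅ k, A.mulVec y k) ≤ 2 := by
    unfold normP at hAy; linarith
  refine ⟨?_, fun j hj => ?_, fun i hi => ?_⟩
  · have := key i₀ j₀ hi₀ hj₀
    unfold normP
    linarith [hle i₀, hge j₀]
  · have := key i₀ j hi₀ hj
    simp only [Set.mem_ofPred_eq]
    linarith [hle i₀, hge j]
  · have := key i j₀ hi hj₀
    simp only [Set.mem_ofPred_eq]
    linarith [hle i, hge j₀]

lemma mulVec_mem_Oface_of_normP_eq_one {n : ℕ} {A : Matrix (Fin n) (Fin n) ℝ}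
    (hA : ∀ x : Fin n → ℝ, normP (A.mulVec x) ≤ normP x) {S T : Set (Fin n)} (hS : S.Nonempty)
    (hT : T.Nonempty) {x y : Fin n → ℝ} (hx : x ∈ Oface S T) (hy : y ∈ Oface S T)
    (hAx : normP (A.mulVec x) = 1) :
    A.mulVec y ∈ Oface {i | A.mulVec x i = ⨅ k, A.mulVec x k}
      {i | A.mulVec x i = ⨆ k, A.mulVec x k} := by
  obtain ⟨hAy, hmin, hmax⟩ := argmin_argmax_mulVec_subset hA hS hT hx hy hAx
  obtain ⟨-, hmin', hmax'⟩ := argmin_argmax_mulVec_subset hA hS hT hy hx hAy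
  refine ⟨?_, hmin'.antisymm hmin, hmax'.antisymm hmax⟩
  unfold normP at hAy
  linarith

theorem stmt4 (n : ℕ) (hn : 2 ≤ n) (A : Matrix (Fin n) (Fin n) ℝ)
    (hA : ∀ x : Fin n → ℝ, normP (A.mulVec x) ≤ normP x)
    (S T : Set (Fin n)) (hST : Disjoint S T) (hS : S.Nonempty) (hT : T.Nonempty) :
    Xor'
      (∀ x ∈ Dface S T, normP (A.mulVec x) < 1)
      (∃ S' T' : Set (Fin n), Disjoint S' T' ∧ S'.Nonempty ∧ T'.Nonempty ∧
        (∀ x ∈ Dface S T, A.mulVec x ∈ Dface S' T') ∧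
        ∀ S'' T'' : Set (Fin n), Disjoint S'' T'' → S''.Nonempty → T''.Nonempty →
          (∀ x ∈ Dface S T, A.mulVec x ∈ Dface S'' T'') →
          (S'' = S' ∧ T'' = T') ∨ (S'' = T' ∧ T'' = S')) := by
  have : Nonempty (Fin n) := hS.to_type
  obtain ⟨p, hp⟩ := Oface_nonempty hST hS hT
  by_cases hlt : ∀ x ∈ Dface S T, normP (A.mulVec x) < 1
  · refine Or.inl ⟨hlt, ?_⟩
    rintro ⟨S', T', -, -, -, h, -⟩
    have h1 : normP (A.mulVec p) = 1 := (h p (Or.inl hp)).elim normP_eq_one normP_eq_one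
    exact (hlt p (Or.inl hp)).ne h1
  refine Or.inr ⟨?_, hlt⟩
  obtain ⟨x, hx, hAx⟩ : ∃ x ∈ Oface S T, normP (A.mulVec x) = 1 := by
    push Not at hlt
    obtain ⟨x, hx | hx, h⟩ := hlt
    · exact ⟨x, hx, ((hA x).trans_eq (normP_eq_one hx)).antisymm h⟩
    · refine ⟨-x, neg_mem_Oface hT hS hx, ?_⟩
      rw [Matrix.mulVec_neg, normP_neg]
      exact ((hA x).trans_eq (normP_eq_one hx)).antisymm h
  have hface : ∀ y ∈ Oface S T, A.mulVec y ∈ Oface {i | A.mulVec x i = ⨅ k, A.mulVec x k}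
      {i | A.mulVec x i = ⨆ k, A.mulVec x k} :=
    fun y hy => mulVec_mem_Oface_of_normP_eq_one hA hS hT hx hy hAx
  have hmin : {i | A.mulVec x i = ⨅ k, A.mulVec x k}.Nonempty := exists_eq_ciInf_of_finite
  have hmax : {i | A.mulVec x i = ⨆ k, A.mulVec x k}.Nonempty := exists_eq_ciSup_of_finite
  refine ⟨_, _, ?_, hmin, hmax, ?_, ?_⟩
  · refine Set.disjoint_left.2 fun i hi hi' => ?_
    have h1 := (hface x hx).1
    rw [← Set.mem_ofPred_eq.mp hi, ← Set.mem_ofPred_eq.mp hi'] at h1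
    norm_num at h1
  · rintro y (hy | hy)
    · exact Or.inl (hface y hy)
    · right
      have h := neg_mem_Oface hmin hmax (hface (-y) (neg_mem_Oface hT hS hy))
      rwa [Matrix.mulVec_neg, neg_neg] at h
  · intro S'' T'' _ _ _ h
    rcases h x (Or.inl hx) with ⟨-, h1, h2⟩ | ⟨-, h1, h2⟩
    · exact Or.inl ⟨h1.symm, h2.symm⟩
    · exact Or.inr ⟨h2.symm, h1.symm⟩
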